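/- arXiv:2205.11970 — 2 statements merged into one kernel-verified Lean document; each statement's English description precedes it below -/
import Mathlib

section
/- Let d ≥ 1 be an integer and m, b, M, M′, β > 0. Let F, G ∈ C¹(ℝ^d;ℝ) be nonnegative, (m,b)-dissipative and M-smooth, and let H ∈ C¹(ℝ^d;ℝ) be M′-smooth. Then there exists a constant C₀ > 0 depending only on (m, b, M, M′, β, ‖∇H(0)‖, ‖∇F(0)‖, ‖∇G(0)‖, d) such that |∫_{ℝ^d} H dπ_{β,F} − ∫_{ℝ^d} H dπ_{β,G}| ≤ C₀ (∫_{ℝ^d} ‖∇F(x) − ∇G(x)‖² π_{β,G}(dx))^{1/2}. -/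
open MeasureTheory Real RealInnerProductSpace

noncomputable section

def gibbs (d : ℕ) (β : ℝ) (F : EuclideanSpace ℝ (Fin d) → ℝ) :
    Measure (EuclideanSpace ℝ (Fin d)) :=
  volume.withDensity fun x => ENNReal.ofReal (Real.exp (-β * F x) / ∫ y, Real.exp (-β * F y))

def Dissipative (d : ℕ) (m b : ℝ) (F : EuclideanSpace ℝ (Fin d) → ℝ) : Prop :=
  ∀ x, m * ‖x‖ ^ 2 - b ≤ ⟪gradient F x, x⟫

def LSmooth (d : ℕ) (M : ℝ) (F : EuclideanSpace ℝ (Fin d) → ℝ) : Prop :=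
  ∀ x y, ‖gradient F x - gradient F y‖ ≤ M * ‖x - y‖


/-- Continuously differentiable, `(m, b)`-dissipative and `M`-smooth functions whose gradient at
the origin has norm at most `a`. -/
structure Potential (d : ℕ) (m b M a : ℝ) (F : EuclideanSpace ℝ (Fin d) → ℝ) : Prop where
  contDiff : ContDiff ℝ 1 F
  dissipative : Dissipative d m b F
  smooth : LSmooth d M F
  norm_gradient_zero_le : ‖gradient F 0‖ ≤ a

section Growth

variable {d : ℕ} {F : EuclideanSpace ℝ (Fin d) → ℝ} {m b M a : ℝ}

lemma continuous_gradient_of_contDiff (hF : ContDiff ℝ 1 F) : Continuous (gradient F) :=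
  (InnerProductSpace.toDual ℝ _).symm.continuous.comp (hF.continuous_fderiv one_ne_zero)

lemma norm_gradient_le_add (hs : LSmooth d M F) (x y : EuclideanSpace ℝ (Fin d)) :
    ‖gradient F y‖ ≤ ‖gradient F x‖ + M * ‖y - x‖ := by
  have h := hs y x
  rw [norm_sub_rev] at h
  have h2 := norm_le_norm_add_norm_sub (gradient F x) (gradient F y)
  linarith

lemma abs_sub_le_of_lSmooth (hM : 0 ≤ M) (hF : ContDiff ℝ 1 F) (hs : LSmooth d M F)
    (x y : EuclideanSpace ℝ (Fin d)) :
    |F y - F x| ≤ (‖gradient F x‖ + M * ‖y - x‖) * ‖y - x‖ := by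
  have key := Convex.norm_image_sub_le_of_norm_fderiv_le (𝕜 := ℝ) (f := F)
    (s := Metric.closedBall x ‖y - x‖) (C := ‖gradient F x‖ + M * ‖y - x‖) (x := x) (y := y)
    (fun z _ => hF.differentiable one_ne_zero z) ?_ (convex_closedBall _ _)
    (Metric.mem_closedBall_self (norm_nonneg _)) (by simp [dist_eq_norm])
  · simpa using key
  · intro z hz
    rw [← toDual_gradient, LinearIsometryEquiv.norm_map]
    rw [Metric.mem_closedBall, dist_eq_norm] at hz
    exact (norm_gradient_le_add hs x z).trans (by gcongr)

lemma hasDerivAt_comp_of_contDiff (hF : ContDiff ℝ 1 F) {γ : ℝ → EuclideanSpace ℝ (Fin d)}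
    {γ' : EuclideanSpace ℝ (Fin d)} {t : ℝ} (hγ : HasDerivAt γ γ' t) :
    HasDerivAt (fun s => F (γ s)) ⟪gradient F (γ t), γ'⟫ t := by
  have h := (hF.differentiable one_ne_zero (γ t)).hasFDerivAt.comp_hasDerivAt t hγ
  rwa [← inner_gradient_left] at h

namespace Potential

lemma norm_gradient_le (hF : Potential d m b M a F) (x : EuclideanSpace ℝ (Fin d)) :
    ‖gradient F x‖ ≤ a + M * ‖x‖ := by
  have h := norm_gradient_le_add hF.smooth 0 x
  have := hF.norm_gradient_zero_le
  rw [sub_zero] at h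
  linarith

lemma nonneg (hF : Potential d m b M a F) : 0 ≤ a :=
  (norm_nonneg _).trans hF.norm_gradient_zero_le

lemma le_inner_gradient_smul (hm : 0 < m) (hb : 0 < b) (hM : 0 < M)
    (hF : Potential d m b M a F) (y : EuclideanSpace ℝ (Fin d)) {t : ℝ} (ht : 0 < t) :
    m / 2 * t * ‖y‖ ^ 2 - (a + (M + m) * √(2 * b / m)) * ‖y‖ ≤ ⟪gradient F (t • y), y⟫ := by
  have h1 := hF.dissipative (t • y)
  rw [inner_smul_right, norm_smul, Real.norm_of_nonneg ht.le] at h1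
  have h2 := hF.norm_gradient_le (t • y)
  rw [norm_smul, Real.norm_of_nonneg ht.le] at h2
  have h3 := neg_le_of_abs_le (abs_real_inner_le_norm (gradient F (t • y)) y)
  have ha := hF.nonneg
  set n := ‖y‖
  set i := ⟪gradient F (t • y), y⟫
  set r := √(2 * b / m)
  have hn : 0 ≤ n := norm_nonneg y
  have hr : 0 ≤ r := Real.sqrt_nonneg _
  have hr2 : m * r ^ 2 = 2 * b := by
    rw [Real.sq_sqrt (by positivity)]; field_simp
  rcases le_total r (t * n) with h | h
  · have hsq : m * r ^ 2 ≤ m * (t * n) ^ 2 := by gcongr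
    have : t * (m / 2 * t * n ^ 2) ≤ t * i := by nlinarith
    have := le_of_mul_le_mul_left this ht
    have : 0 ≤ (a + (M + m) * r) * n := by positivity
    linarith
  · have h4 : ‖gradient F (t • y)‖ * n ≤ (a + M * r) * n := by
      gcongr
      exact h2.trans (by gcongr)
    have h5 : m / 2 * (t * n) * n ≤ m / 2 * r * n := by gcongr
    have h6 : 0 ≤ m / 2 * r * n := by positivity
    nlinarith

lemma apply_smul_sub_le (hm : 0 < m) (hb : 0 < b) (hM : 0 < M) (hF : Potential d m b M a F)
    (y : EuclideanSpace ℝ (Fin d)) {s : ℝ} (hs : s ∈ Set.Icc (0 : ℝ) 1) :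
    F (s • y) - F y ≤
      -(m / 8) * (1 - s) * ‖y‖ ^ 2 + 2 * (a + (M + m) * √(2 * b / m)) ^ 2 / m := by
  set c := a + (M + m) * √(2 * b / m) with hc
  have hderiv : ∀ t : ℝ, HasDerivAt (fun t : ℝ => F (t • y) - m / 4 * t ^ 2 * ‖y‖ ^ 2 + c * ‖y‖ * t)
      (⟪gradient F (t • y), y⟫ - m / 2 * t * ‖y‖ ^ 2 + c * ‖y‖) t := by
    intro t
    have h1 : HasDerivAt (fun t : ℝ => F (t • y)) ⟪gradient F (t • y), y⟫ t := by
      refine hasDerivAt_comp_of_contDiff hF.contDiff ?_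
      simpa using (hasDerivAt_id t).smul_const y
    have h2 : HasDerivAt (fun t : ℝ => m / 4 * t ^ 2 * ‖y‖ ^ 2) (m / 2 * t * ‖y‖ ^ 2) t := by
      refine (((hasDerivAt_pow 2 t).const_mul (m / 4)).mul_const (‖y‖ ^ 2)).congr_deriv ?_
      norm_num only [Nat.cast_ofNat, pow_one]
      ring
    have h3 : HasDerivAt (fun t : ℝ => c * ‖y‖ * t) (c * ‖y‖) t := by
      simpa using (hasDerivAt_id t).const_mul (c * ‖y‖)
    exact (h1.sub h2).add h3
  have hmono : MonotoneOn (fun t : ℝ => F (t • y) - m / 4 * t ^ 2 * ‖y‖ ^ 2 + c * ‖y‖ * t)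
      (Set.Icc 0 1) := by
    refine monotoneOn_of_deriv_nonneg (convex_Icc 0 1)
      (fun t _ => (hderiv t).continuousAt.continuousWithinAt)
      (fun t _ => (hderiv t).differentiableAt.differentiableWithinAt) fun t ht => ?_
    rw [interior_Icc] at ht
    rw [(hderiv t).deriv]
    linarith [le_inner_gradient_smul hm hb hM hF y ht.1]
  have h := hmono hs (Set.right_mem_Icc.2 zero_le_one) hs.2
  simp only [one_smul] at h
  obtain ⟨hs0, hs1⟩ := hs
  have h1 : c * ‖y‖ ≤ m / 8 * ‖y‖ ^ 2 + 2 * c ^ 2 / m := by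
    have : m / 8 * ‖y‖ ^ 2 + 2 * c ^ 2 / m - c * ‖y‖ = (m * ‖y‖ - 4 * c) ^ 2 / (8 * m) := by
      field_simp; ring
    have : 0 ≤ (m * ‖y‖ - 4 * c) ^ 2 / (8 * m) := by positivity
    linarith
  have h2 : (1 - s) * (c * ‖y‖) ≤ (1 - s) * (m / 8 * ‖y‖ ^ 2) + 2 * c ^ 2 / m := by
    have h3 : (1 - s) * (c * ‖y‖) ≤ (1 - s) * (m / 8 * ‖y‖ ^ 2 + 2 * c ^ 2 / m) :=
      mul_le_mul_of_nonneg_left h1 (by linarith)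
    have h4 : 0 ≤ s * (2 * c ^ 2 / m) := by positivity
    linarith
  have h5 : 0 ≤ m / 4 * (s * (1 - s)) * ‖y‖ ^ 2 := by
    have : 0 ≤ 1 - s := by linarith
    positivity
  nlinarith

lemma apply_smul_add_smul_sub_le (hm : 0 < m) (hb : 0 < b) (hM : 0 < M)
    (hF : Potential d m b M a F) (y z : EuclideanSpace ℝ (Fin d)) {p q : ℝ} (hp : 0 ≤ p)
    (hpq : p ^ 2 + q ^ 2 = 1) :
    F (p • y + q • z) - F y ≤ -(m / 32) * (q * ‖y‖) ^ 2 + (8 * M ^ 2 / m + M + 1) * ‖z‖ ^ 2 +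
      (2 * (a + (M + m) * √(2 * b / m)) ^ 2 / m + a ^ 2) := by
  have hp1 : p ≤ 1 := by nlinarith [sq_nonneg q]
  have h1 := hF.apply_smul_sub_le hm hb hM y ⟨hp, hp1⟩
  have h2 := le_of_abs_le (abs_sub_le_of_lSmooth hM.le hF.contDiff hF.smooth (p • y)
    (p • y + q • z))
  have h3 := hF.norm_gradient_le (p • y)
  have ha := hF.nonneg
  rw [add_sub_cancel_left, norm_smul, Real.norm_eq_abs] at h2
  rw [norm_smul, Real.norm_of_nonneg hp] at h3
  set C := 2 * (a + (M + m) * √(2 * b / m)) ^ 2 / m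
  have hy : 0 ≤ ‖y‖ := norm_nonneg y
  have hz : 0 ≤ ‖z‖ := norm_nonneg z
  set Y := ‖y‖
  set Z := ‖z‖
  have hq1 : |q| ≤ 1 := by
    rw [← sq_le_one_iff_abs_le_one]; nlinarith [sq_nonneg p]
  have hq0 := abs_nonneg q
  have hqq : (q * Y) ^ 2 = (|q| * Y) ^ 2 := by rw [mul_pow, mul_pow, sq_abs]
  have h4 : (‖gradient F (p • y)‖ + M * (|q| * Z)) * (|q| * Z) ≤
      a * Z + M * (|q| * Y) * Z + M * Z ^ 2 := by
    have hpY : p * Y ≤ Y := by nlinarith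
    have hqZ : |q| * Z ≤ Z := by nlinarith
    calc (‖gradient F (p • y)‖ + M * (|q| * Z)) * (|q| * Z)
        ≤ (a + M * Y + M * Z) * (|q| * Z) := by
          gcongr
          exact h3.trans (by gcongr)
      _ = a * (|q| * Z) + M * (|q| * Y) * Z + M * Z * (|q| * Z) := by ring
      _ ≤ a * Z + M * (|q| * Y) * Z + M * Z * Z := by gcongr
      _ = _ := by ring
  have h5 : M * (|q| * Y) * Z ≤ m / 32 * (|q| * Y) ^ 2 + 8 * M ^ 2 / m * Z ^ 2 := by
    have h : m / 32 * (|q| * Y) ^ 2 + 8 * M ^ 2 / m * Z ^ 2 - M * (|q| * Y) * Z =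
      (m * (|q| * Y) - 16 * M * Z) ^ 2 / (32 * m) := by field_simp; ring
    have : 0 ≤ (m * (|q| * Y) - 16 * M * Z) ^ 2 / (32 * m) := by positivity
    linarith
  have h6 : a * Z ≤ a ^ 2 + Z ^ 2 := by nlinarith [sq_nonneg (a - Z)]
  have h7 : (q * Y) ^ 2 / 2 ≤ (1 - p) * Y ^ 2 := by
    have : q ^ 2 / 2 ≤ 1 - p := by nlinarith
    have := mul_le_mul_of_nonneg_right this (sq_nonneg Y)
    linarith [mul_pow q Y 2]
  have h8 := mul_le_mul_of_nonneg_left h7 hm.le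
  rw [← hqq] at h5
  linarith

end Potential

end Growth

section Density

variable {d : ℕ} {F : EuclideanSpace ℝ (Fin d) → ℝ} {m b M a β : ℝ}

lemma integrable_exp_neg_mul_norm_sq {c : ℝ} (hc : 0 < c) :
    Integrable fun x : EuclideanSpace ℝ (Fin d) => rexp (-c * ‖x‖ ^ 2) := by
  have h := (GaussianFourier.integrable_cexp_neg_mul_sq_norm_add
    (V := EuclideanSpace ℝ (Fin d)) (b := (c : ℂ)) (by simpa) 0 0).re
  refine h.congr (ae_of_all _ fun x => ?_)
  simp only [zero_mul, add_zero]
  rw [← Complex.ofReal_pow, ← Complex.ofReal_neg, ← Complex.ofReal_mul, ← Complex.ofReal_exp]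
  rfl

lemma integrable_sq_mul_exp_neg_mul_norm_sq {c : ℝ} (hc : 0 < c) :
    Integrable fun x : EuclideanSpace ℝ (Fin d) => (1 + ‖x‖ ^ 2) ^ 2 * rexp (-c * ‖x‖ ^ 2) := by
  refine ((integrable_exp_neg_mul_norm_sq (d := d) (half_pos hc)).const_mul
    ((1 + 4 / c) ^ 2)).mono' (by fun_prop) (ae_of_all _ fun x => ?_)
  rw [Real.norm_of_nonneg (by positivity)]
  have h1 : 1 + ‖x‖ ^ 2 ≤ (1 + 4 / c) * rexp (c / 4 * ‖x‖ ^ 2) := by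
    have h2 : 1 + ‖x‖ ^ 2 ≤ (1 + 4 / c) * (c / 4 * ‖x‖ ^ 2 + 1) := by
      have : (1 + 4 / c) * (c / 4 * ‖x‖ ^ 2 + 1) =
        1 + ‖x‖ ^ 2 + (4 / c + c / 4 * ‖x‖ ^ 2) := by field_simp; ring
      have : 0 ≤ 4 / c + c / 4 * ‖x‖ ^ 2 := by positivity
      linarith
    refine h2.trans ?_
    gcongr
    exact Real.add_one_le_exp _
  calc (1 + ‖x‖ ^ 2) ^ 2 * rexp (-c * ‖x‖ ^ 2)
      ≤ ((1 + 4 / c) * rexp (c / 4 * ‖x‖ ^ 2)) ^ 2 * rexp (-c * ‖x‖ ^ 2) := by gcongr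
    _ = (1 + 4 / c) ^ 2 * rexp (-(c / 2) * ‖x‖ ^ 2) := by
      rw [mul_pow, ← Real.exp_nat_mul, mul_assoc, ← Real.exp_add]
      congr 2
      push_cast
      ring

lemma integral_exp_neg_mul_norm_sq_pos {c : ℝ} (hc : 0 < c) :
    0 < ∫ x : EuclideanSpace ℝ (Fin d), rexp (-c * ‖x‖ ^ 2) :=
  integral_exp_pos (integrable_exp_neg_mul_norm_sq hc)

/-- The density of `gibbs d β F`. -/
def gibbsDensity (d : ℕ) (β : ℝ) (F : EuclideanSpace ℝ (Fin d) → ℝ)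
    (x : EuclideanSpace ℝ (Fin d)) : ℝ :=
  rexp (-β * F x) / ∫ y, rexp (-β * F y)

lemma gibbsDensity_nonneg (x : EuclideanSpace ℝ (Fin d)) : 0 ≤ gibbsDensity d β F x :=
  div_nonneg (Real.exp_nonneg _) (integral_nonneg fun _ => Real.exp_nonneg _)

lemma continuous_gibbsDensity (hF : Continuous F) : Continuous (gibbsDensity d β F) := by
  unfold gibbsDensity
  fun_prop

lemma integral_gibbs (hF : Continuous F) (f : EuclideanSpace ℝ (Fin d) → ℝ) :
    ∫ x, f x ∂(gibbs d β F) = ∫ x, f x * gibbsDensity d β F x := by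
  have hc := continuous_gibbsDensity (β := β) hF
  change ∫ x, f x ∂(volume.withDensity fun x => ENNReal.ofReal (gibbsDensity d β F x)) = _
  rw [integral_withDensity_eq_integral_toReal_smul (by fun_prop) (by simp)]
  refine integral_congr_ae (ae_of_all _ fun x => ?_)
  simp only [ENNReal.toReal_ofReal (gibbsDensity_nonneg x), smul_eq_mul, mul_comm]

namespace Potential

lemma exp_le (hm : 0 < m) (hb : 0 < b) (hM : 0 < M) (hβ : 0 < β)
    (hF : Potential d m b M a F) (x : EuclideanSpace ℝ (Fin d)) :
    rexp (-β * F x) ≤ rexp (-β * F 0) *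
      (rexp (β * (2 * (a + (M + m) * √(2 * b / m)) ^ 2 / m)) *
        rexp (-(β * m / 8) * ‖x‖ ^ 2)) := by
  have h := hF.apply_smul_sub_le hm hb hM x (s := 0) (by simp)
  rw [zero_smul] at h
  rw [← Real.exp_add, ← Real.exp_add, Real.exp_le_exp]
  have := mul_le_mul_of_nonneg_left h hβ.le
  linarith

lemma le_exp (hM : 0 < M) (hβ : 0 < β)
    (hF : Potential d m b M a F) (x : EuclideanSpace ℝ (Fin d)) :
    rexp (-β * F 0) * (rexp (-β * a ^ 2) * rexp (-(β * (M + 1)) * ‖x‖ ^ 2)) ≤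
      rexp (-β * F x) := by
  have h := le_of_abs_le (abs_sub_le_of_lSmooth hM.le hF.contDiff hF.smooth 0 x)
  rw [sub_zero] at h
  have h2 : ‖gradient F 0‖ * ‖x‖ ≤ a * ‖x‖ := by
    gcongr
    exact hF.norm_gradient_zero_le
  have h3 : F x - F 0 ≤ a ^ 2 + (M + 1) * ‖x‖ ^ 2 := by nlinarith [sq_nonneg (a - ‖x‖)]
  rw [← Real.exp_add, ← Real.exp_add, Real.exp_le_exp]
  have := mul_le_mul_of_nonneg_left h3 hβ.le
  linarith

lemma integrable_exp (hm : 0 < m) (hb : 0 < b) (hM : 0 < M) (hβ : 0 < β)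
    (hF : Potential d m b M a F) : Integrable fun x => rexp (-β * F x) := by
  have hc := hF.contDiff.continuous
  refine (((integrable_exp_neg_mul_norm_sq (c := β * m / 8) (by positivity)).const_mul _).const_mul
    _).mono' (by fun_prop) (ae_of_all _ fun x =>
      (Real.norm_of_nonneg (Real.exp_nonneg _)).trans_le (hF.exp_le hm hb hM hβ x))

lemma integral_gibbsDensity (hm : 0 < m) (hb : 0 < b) (hM : 0 < M) (hβ : 0 < β)
    (hF : Potential d m b M a F) : ∫ x, gibbsDensity d β F x = 1 := by
  unfold gibbsDensity
  rw [integral_div]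
  exact div_self (integral_exp_pos (hF.integrable_exp hm hb hM hβ)).ne'

lemma gibbsDensity_le (hm : 0 < m) (hb : 0 < b) (hM : 0 < M) (hβ : 0 < β)
    (hF : Potential d m b M a F) (x : EuclideanSpace ℝ (Fin d)) :
    gibbsDensity d β F x ≤
      rexp (β * (2 * (a + (M + m) * √(2 * b / m)) ^ 2 / m)) /
        (rexp (-β * a ^ 2) *
          ∫ y : EuclideanSpace ℝ (Fin d), rexp (-(β * (M + 1)) * ‖y‖ ^ 2)) *
      rexp (-(β * m / 8) * ‖x‖ ^ 2) := by
  have hI := integrable_exp_neg_mul_norm_sq (d := d) (c := β * (M + 1)) (by positivity)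
  have hpos := integral_exp_neg_mul_norm_sq_pos (d := d) (c := β * (M + 1)) (by positivity)
  have h := integral_mono ((hI.const_mul _).const_mul _) (hF.integrable_exp hm hb hM hβ)
    (hF.le_exp hM hβ)
  simp only [integral_const_mul] at h
  unfold gibbsDensity
  calc _ ≤ rexp (-β * F 0) * (rexp (β * (2 * (a + (M + m) * √(2 * b / m)) ^ 2 / m)) *
        rexp (-(β * m / 8) * ‖x‖ ^ 2)) / (rexp (-β * F 0) * (rexp (-β * a ^ 2) *
          ∫ y : EuclideanSpace ℝ (Fin d), rexp (-(β * (M + 1)) * ‖y‖ ^ 2))) := by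
        gcongr
        exact hF.exp_le hm hb hM hβ x
    _ = _ := by
        rw [mul_div_mul_left _ _ (Real.exp_ne_zero _)]
        ring

end Potential

/-- Uniform Gaussian domination of the densities of all Gibbs measures of a class of potentials. -/
lemma exists_gibbsDensity_le (d : ℕ) (a : ℝ) (hm : 0 < m) (hb : 0 < b) (hM : 0 < M) (hβ : 0 < β) :
    ∃ K : ℝ, 0 < K ∧ ∀ F, Potential d m b M a F → ∀ x,
      gibbsDensity d β F x ≤ K * rexp (-(β * m / 8) * ‖x‖ ^ 2) := by
  have hpos := integral_exp_neg_mul_norm_sq_pos (d := d) (c := β * (M + 1)) (by positivity)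
  exact ⟨_, by positivity, fun F hF => hF.gibbsDensity_le hm hb hM hβ⟩

/-- A continuous function of at most quartic growth is integrable against the Gibbs density, with a
uniform bound. -/
lemma integrable_mul_gibbsDensity (hm : 0 < m) (hβ : 0 < β) {K L : ℝ} (hF : Continuous F)
    (hK : ∀ x, gibbsDensity d β F x ≤ K * rexp (-(β * m / 8) * ‖x‖ ^ 2))
    {f : EuclideanSpace ℝ (Fin d) → ℝ} (hf : Continuous f)
    (hfL : ∀ x, |f x| ≤ L * (1 + ‖x‖ ^ 2) ^ 2) :
    Integrable (fun x => f x * gibbsDensity d β F x) ∧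
      |∫ x, f x * gibbsDensity d β F x| ≤ L * K *
        ∫ x : EuclideanSpace ℝ (Fin d), (1 + ‖x‖ ^ 2) ^ 2 * rexp (-(β * m / 8) * ‖x‖ ^ 2) := by
  have hI := (integrable_sq_mul_exp_neg_mul_norm_sq (d := d) (c := β * m / 8)
    (by positivity)).const_mul (L * K)
  have hle : ∀ x, ‖f x * gibbsDensity d β F x‖ ≤
      L * K * ((1 + ‖x‖ ^ 2) ^ 2 * rexp (-(β * m / 8) * ‖x‖ ^ 2)) := fun x => by
    rw [norm_mul, Real.norm_eq_abs, Real.norm_of_nonneg (gibbsDensity_nonneg x)]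
    calc _ ≤ (L * (1 + ‖x‖ ^ 2) ^ 2) * (K * rexp (-(β * m / 8) * ‖x‖ ^ 2)) :=
          mul_le_mul (hfL x) (hK x) (gibbsDensity_nonneg x) ((abs_nonneg _).trans (hfL x))
      _ = _ := by ring
  refine ⟨hI.mono' (hf.mul (continuous_gibbsDensity hF)).aestronglyMeasurable
    (ae_of_all _ hle), ?_⟩
  rw [← integral_const_mul, ← Real.norm_eq_abs]
  exact norm_integral_le_of_norm_le hI (ae_of_all _ hle)

end Density

section Rotation

open ContinuousLinearMap (rotation)

lemma norm_rotation_fst_sq_add_norm_rotation_snd_sq {E : Type*} [NormedAddCommGroup E]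
    [InnerProductSpace ℝ E] (θ : ℝ) (p : E × E) :
    ‖(rotation θ p).1‖ ^ 2 + ‖(rotation θ p).2‖ ^ 2 = ‖p.1‖ ^ 2 + ‖p.2‖ ^ 2 := by
  simp only [ContinuousLinearMap.rotation_apply]
  rw [@norm_add_sq_real, @norm_add_sq_real]
  simp only [norm_smul, inner_smul_left, inner_smul_right, mul_pow, norm_neg, Real.norm_eq_abs,
    sq_abs, conj_trivial]
  linear_combination (‖p.1‖ ^ 2 + ‖p.2‖ ^ 2) * Real.sin_sq_add_cos_sq θ

/-- The rotation of angle `θ` as a linear isometry of the `L²` product. -/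
def rotationIsometry (E : Type*) [NormedAddCommGroup E] [InnerProductSpace ℝ E] (θ : ℝ) :
    WithLp 2 (E × E) →ₗᵢ[ℝ] WithLp 2 (E × E) where
  toLinearMap := (WithLp.linearEquiv 2 ℝ (E × E)).symm.toLinearMap ∘ₗ
    (rotation θ : E × E →L[ℝ] E × E).toLinearMap ∘ₗ (WithLp.linearEquiv 2 ℝ (E × E)).toLinearMap
  norm_map' v := by
    rw [← sq_eq_sq₀ (norm_nonneg _) (norm_nonneg _), WithLp.prod_norm_sq_eq_of_L2,
      WithLp.prod_norm_sq_eq_of_L2]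
    exact norm_rotation_fst_sq_add_norm_rotation_snd_sq θ (WithLp.ofLp v)

lemma measurePreserving_rotation {E : Type*} [NormedAddCommGroup E] [InnerProductSpace ℝ E]
    [FiniteDimensional ℝ E] [MeasurableSpace E] [BorelSpace E] (θ : ℝ) :
    MeasurePreserving (rotation θ : E × E →L[ℝ] E × E) := by
  have hg := ((rotationIsometry E θ).toLinearIsometryEquiv rfl).measurePreserving
  exact ((WithLp.volume_preserving_ofLp E E).comp hg).comp (WithLp.volume_preserving_toLp E E)

lemma abs_integral_le_of_le_integral_rotation
    {E : Type*} [NormedAddCommGroup E] [InnerProductSpace ℝ E]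
    [FiniteDimensional ℝ E] [MeasurableSpace E] [BorelSpace E]
    {f g : E × E → ℝ} (hg : Continuous g)
    (hg0 : ∀ p, 0 ≤ g p) (hgi : Integrable g)
    (hfg : ∀ p, |f p| ≤ ∫ θ in 0..(π / 2), g (rotation θ p)) :
    |∫ p, f p| ≤ π / 2 * ∫ p, g p := by
  have hcont : Continuous fun q : (E × E) × ℝ => g (rotation q.2 q.1) := by
    simp only [ContinuousLinearMap.rotation_apply]
    fun_prop
  have hπ : (0 : ℝ) ≤ π / 2 := by positivity
  have hbound : ∀ p, ‖f p‖ₑ ≤ ∫⁻ θ in Set.Ioc 0 (π / 2), ENNReal.ofReal (g (rotation θ p)) := by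
    intro p
    have hp : Continuous fun θ : ℝ => g (rotation θ p) := by
      simp only [ContinuousLinearMap.rotation_apply]
      fun_prop
    have hpi : IntegrableOn (fun θ : ℝ => g (rotation θ p)) (Set.Ioc 0 (π / 2)) :=
      hp.integrableOn_Icc.mono_set Set.Ioc_subset_Icc_self
    calc ‖f p‖ₑ = ENNReal.ofReal |f p| := Real.enorm_eq_ofReal_abs _
      _ ≤ ENNReal.ofReal (∫ θ in 0..(π / 2), g (rotation θ p)) :=
        ENNReal.ofReal_le_ofReal (hfg p)
      _ = _ := by
        rw [intervalIntegral.integral_of_le hπ]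
        exact ofReal_integral_eq_lintegral_ofReal hpi (ae_of_all _ fun θ => hg0 _)
  have hgI : 0 ≤ ∫ p, g p := integral_nonneg hg0
  rw [← ENNReal.ofReal_le_ofReal_iff (by positivity), ← Real.enorm_eq_ofReal_abs]
  calc ‖∫ p, f p‖ₑ ≤ ∫⁻ p, ‖f p‖ₑ := enorm_integral_le_lintegral_enorm _
    _ ≤ ∫⁻ p, ∫⁻ θ in Set.Ioc 0 (π / 2), ENNReal.ofReal (g (rotation θ p)) :=
      lintegral_mono hbound
    _ = ∫⁻ θ in Set.Ioc 0 (π / 2), ∫⁻ p, ENNReal.ofReal (g (rotation θ p)) := by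
      refine lintegral_lintegral_swap (Measurable.aemeasurable ?_)
      exact hcont.measurable.ennreal_ofReal
    _ = ∫⁻ θ in Set.Ioc 0 (π / 2), ∫⁻ p, ENNReal.ofReal (g p) := by
      refine lintegral_congr fun θ => ?_
      exact (measurePreserving_rotation θ).lintegral_comp hg.measurable.ennreal_ofReal
    _ = ENNReal.ofReal (π / 2 * ∫ p, g p) := by
      rw [← ofReal_integral_eq_lintegral_ofReal hgi (ae_of_all _ hg0), setLIntegral_const,
        Real.volume_Ioc, sub_zero, ← ENNReal.ofReal_mul hgI, mul_comm]

end Rotation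

section Comparison

variable {d : ℕ} {F G h : EuclideanSpace ℝ (Fin d) → ℝ} {m b M a β L A K c : ℝ}

open ContinuousLinearMap (rotation)

/-- The exponential of a potential grows controllably along the rotations: the growth is absorbed
by a Gaussian weight in the second variable. -/
lemma Potential.exp_rotation_le (hm : 0 < m) (hb : 0 < b) (hM : 0 < M) (hβ : 0 < β)
    (hF : Potential d m b M a F) {θ : ℝ} (hθ : 0 ≤ Real.cos θ)
    (p : EuclideanSpace ℝ (Fin d) × EuclideanSpace ℝ (Fin d)) :
    rexp (β * (F (rotation θ p).1 - F p.1)) *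
        rexp (-(β * (8 * M ^ 2 / m + M + 1 + m / 32)) * ‖p.2‖ ^ 2) ≤
      rexp (β * (2 * (a + (M + m) * √(2 * b / m)) ^ 2 / m + a ^ 2)) *
        rexp (-(β * m / 64) * ‖(rotation θ p).2‖ ^ 2) := by
  have h := hF.apply_smul_add_smul_sub_le hm hb hM p.1 p.2 hθ (Real.cos_sq_add_sin_sq θ)
  have hw : ‖(rotation θ p).2‖ ^ 2 ≤ 2 * ((Real.sin θ * ‖p.1‖) ^ 2 + ‖p.2‖ ^ 2) := by
    have h1 : ‖(rotation θ p).2‖ ≤ |Real.sin θ| * ‖p.1‖ + ‖p.2‖ := by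
      rw [ContinuousLinearMap.rotation_apply]
      refine (norm_add_le _ _).trans ?_
      rw [norm_smul, norm_smul, norm_neg, Real.norm_eq_abs, Real.norm_eq_abs]
      have := mul_le_mul_of_nonneg_right (Real.abs_cos_le_one θ) (norm_nonneg p.2)
      linarith
    have h2 : (Real.sin θ * ‖p.1‖) ^ 2 = (|Real.sin θ| * ‖p.1‖) ^ 2 := by
      rw [mul_pow, mul_pow, sq_abs]
    rw [h2]
    have h3 := pow_le_pow_left₀ (norm_nonneg _) h1 2
    nlinarith [sq_nonneg (|Real.sin θ| * ‖p.1‖ - ‖p.2‖)]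
  rw [← Real.exp_add, ← Real.exp_add, Real.exp_le_exp]
  have h3 := mul_le_mul_of_nonneg_left h hβ.le
  have h4 := mul_le_mul_of_nonneg_left hw (by positivity : 0 ≤ β * m / 64)
  rw [ContinuousLinearMap.rotation_apply] at h4 ⊢
  linarith

/-- The integrand dominating the comparison of two Gibbs measures in rotated coordinates. -/
def comparisonBound (β c : ℝ) (F G : EuclideanSpace ℝ (Fin d) → ℝ)
    (p : EuclideanSpace ℝ (Fin d) × EuclideanSpace ℝ (Fin d)) : ℝ :=
  (1 + ‖p.1‖ ^ 2) * ‖gradient F p.1 - gradient G p.1‖ * rexp (-β * G p.1) *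
    ((1 + ‖p.2‖ ^ 2) ^ 2 * rexp (-c * ‖p.2‖ ^ 2))

lemma hasDerivAt_rotation_fst {E : Type*} [NormedAddCommGroup E] [NormedSpace ℝ E]
    (p : E × E) (θ : ℝ) :
    HasDerivAt (fun θ => (rotation θ p).1) (rotation θ p).2 θ :=
  ((Real.hasDerivAt_cos θ).smul_const p.1).add ((Real.hasDerivAt_sin θ).smul_const p.2)

lemma mul_exp_rotation_le (hβ : 0 ≤ β) (hK : 0 ≤ K)
    (hh : ∀ y, |h y| ≤ L * (1 + ‖y‖ ^ 2)) {θ : ℝ}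
    (p : EuclideanSpace ℝ (Fin d) × EuclideanSpace ℝ (Fin d))
    (hkey : rexp (β * (F (rotation θ p).1 - F p.1)) * rexp (-A * ‖p.2‖ ^ 2) ≤
      K * rexp (-c * ‖(rotation θ p).2‖ ^ 2)) :
    |h p.1 * rexp (-β * F p.1) * rexp (-A * ‖p.2‖ ^ 2)| *
        |rexp (β * (F (rotation θ p).1 - G (rotation θ p).1)) *
          (β * ⟪gradient F (rotation θ p).1 - gradient G (rotation θ p).1, (rotation θ p).2⟫)| ≤
      β * L * K * comparisonBound β c F G (rotation θ p) := by
  have hL : 0 ≤ L := by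
    have h0 := (abs_nonneg _).trans (hh 0)
    simpa using h0
  have hsq := norm_rotation_fst_sq_add_norm_rotation_snd_sq θ p
  have hinner := abs_real_inner_le_norm
    (gradient F (rotation θ p).1 - gradient G (rotation θ p).1) (rotation θ p).2
  unfold comparisonBound
  set x := (rotation θ p).1
  set w := (rotation θ p).2
  set D := gradient F x - gradient G x
  have h1 : |h p.1| ≤ L * ((1 + ‖x‖ ^ 2) * (1 + ‖w‖ ^ 2)) := by
    refine (hh p.1).trans (mul_le_mul_of_nonneg_left ?_ hL)
    nlinarith [sq_nonneg ‖p.2‖, mul_nonneg (sq_nonneg ‖x‖) (sq_nonneg ‖w‖)]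
  have h2 : ‖w‖ ≤ 1 + ‖w‖ ^ 2 := by nlinarith [sq_nonneg (‖w‖ - 1)]
  have hexp : rexp (-β * F p.1) * rexp (β * (F x - G x)) =
      rexp (β * (F x - F p.1)) * rexp (-β * G x) := by
    rw [← Real.exp_add, ← Real.exp_add]
    congr 1
    ring
  simp only [abs_mul, Real.abs_exp, abs_of_nonneg hβ]
  calc |h p.1| * rexp (-β * F p.1) * rexp (-A * ‖p.2‖ ^ 2) *
        (rexp (β * (F x - G x)) * (β * |⟪D, w⟫|))
      = |h p.1| * (rexp (-β * F p.1) * rexp (β * (F x - G x))) * rexp (-A * ‖p.2‖ ^ 2) *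
        (β * |⟪D, w⟫|) := by ring
    _ = |h p.1| * (rexp (β * (F x - F p.1)) * rexp (-A * ‖p.2‖ ^ 2)) * rexp (-β * G x) *
        (β * |⟪D, w⟫|) := by rw [hexp]; ring
    _ ≤ (L * ((1 + ‖x‖ ^ 2) * (1 + ‖w‖ ^ 2))) * (K * rexp (-c * ‖w‖ ^ 2)) * rexp (-β * G x) *
        (β * (‖D‖ * (1 + ‖w‖ ^ 2))) := by
      gcongr
      exact hinner.trans (by gcongr)
    _ = _ := by ring

lemma continuous_comparisonBound (hF : ContDiff ℝ 1 F) (hG : ContDiff ℝ 1 G) :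
    Continuous (comparisonBound β c F G) := by
  have h1 := continuous_gradient_of_contDiff hF
  have h2 := continuous_gradient_of_contDiff hG
  have h3 := hG.continuous
  unfold comparisonBound
  fun_prop

lemma comparisonBound_nonneg (p : EuclideanSpace ℝ (Fin d) × EuclideanSpace ℝ (Fin d)) :
    0 ≤ comparisonBound β c F G p := by
  unfold comparisonBound
  positivity

lemma abs_mul_sub_le_integral_rotation (hF : ContDiff ℝ 1 F) (hG : ContDiff ℝ 1 G)
    (hβ : 0 ≤ β) (hK : 0 ≤ K) (hh : ∀ y, |h y| ≤ L * (1 + ‖y‖ ^ 2))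
    (p : EuclideanSpace ℝ (Fin d) × EuclideanSpace ℝ (Fin d))
    (hkey : ∀ θ, 0 ≤ Real.cos θ →
      rexp (β * (F (rotation θ p).1 - F p.1)) * rexp (-A * ‖p.2‖ ^ 2) ≤
        K * rexp (-c * ‖(rotation θ p).2‖ ^ 2)) :
    |h p.1 * rexp (-β * F p.1) * rexp (-A * ‖p.2‖ ^ 2) *
        (rexp (β * (F p.1 - G p.1)) - rexp (β * (F p.2 - G p.2)))| ≤
      ∫ θ in 0..(π / 2), β * L * K * comparisonBound β c F G (rotation θ p) := by
  have hπ : (0 : ℝ) ≤ π / 2 := by positivity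
  have hgF := continuous_gradient_of_contDiff hF
  have hgG := continuous_gradient_of_contDiff hG
  have hFc := hF.continuous
  have hGc := hG.continuous
  have hrot : Continuous fun θ : ℝ => rotation θ p := by
    simp only [ContinuousLinearMap.rotation_apply]
    fun_prop
  have hderiv : ∀ θ : ℝ, HasDerivAt
      (fun θ => rexp (β * (F (rotation θ p).1 - G (rotation θ p).1)))
      (rexp (β * (F (rotation θ p).1 - G (rotation θ p).1)) *
        (β * ⟪gradient F (rotation θ p).1 - gradient G (rotation θ p).1, (rotation θ p).2⟫)) θ := by
    intro θ
    have hr := hasDerivAt_rotation_fst p θ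
    rw [inner_sub_left]
    exact (((hasDerivAt_comp_of_contDiff hF hr).sub
      (hasDerivAt_comp_of_contDiff hG hr)).const_mul β).exp
  have hcont : Continuous fun θ : ℝ => rexp (β * (F (rotation θ p).1 - G (rotation θ p).1)) *
        (β * ⟪gradient F (rotation θ p).1 - gradient G (rotation θ p).1, (rotation θ p).2⟫) := by
    fun_prop
  have hftc := intervalIntegral.integral_eq_sub_of_hasDerivAt (a := 0) (b := π / 2)
    (fun θ _ => hderiv θ) (hcont.intervalIntegrable _ _)
  have h0 : (rotation 0 p).1 = p.1 := by simp [ContinuousLinearMap.rotation_apply]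
  have h1 : (rotation (π / 2) p).1 = p.2 := by simp [ContinuousLinearMap.rotation_apply]
  rw [h0, h1] at hftc
  rw [abs_mul, abs_sub_comm (rexp _), ← hftc]
  have hC : Continuous fun θ : ℝ => comparisonBound β c F G (rotation θ p) :=
    (continuous_comparisonBound hF hG).comp hrot
  refine (mul_le_mul_of_nonneg_left (intervalIntegral.abs_integral_le_integral_abs hπ)
    (abs_nonneg _)).trans ?_
  rw [← intervalIntegral.integral_const_mul]
  refine intervalIntegral.integral_mono_on hπ
    ((continuous_const.mul hcont.abs).intervalIntegrable _ _)
    ((continuous_const.mul hC).intervalIntegrable _ _) fun θ hθ => ?_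
  exact mul_exp_rotation_le hβ hK hh p
    (hkey θ (Real.cos_nonneg_of_mem_Icc ⟨by linarith [hθ.1], hθ.2⟩))

lemma abs_integral_mul_exp_le (hF : ContDiff ℝ 1 F) (hG : ContDiff ℝ 1 G)
    (hβ : 0 ≤ β) (hK : 0 ≤ K) (hc : 0 < c) (hA : 0 < A)
    (hh : ∀ y, |h y| ≤ L * (1 + ‖y‖ ^ 2))
    (hkey : ∀ θ (p : EuclideanSpace ℝ (Fin d) × EuclideanSpace ℝ (Fin d)), 0 ≤ Real.cos θ →
      rexp (β * (F (rotation θ p).1 - F p.1)) * rexp (-A * ‖p.2‖ ^ 2) ≤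
        K * rexp (-c * ‖(rotation θ p).2‖ ^ 2))
    (hhF : Integrable fun x => h x * rexp (-β * F x)) (hhF0 : ∫ x, h x * rexp (-β * F x) = 0)
    (hhG : Integrable fun x => h x * rexp (-β * G x)) (hGi : Integrable fun x => rexp (-β * G x))
    (hD : Integrable fun x =>
      (1 + ‖x‖ ^ 2) * ‖gradient F x - gradient G x‖ * rexp (-β * G x)) :
    (∫ z : EuclideanSpace ℝ (Fin d), rexp (-A * ‖z‖ ^ 2)) * |∫ x, h x * rexp (-β * G x)| ≤
      π / 2 * (β * L * K * ((∫ x, (1 + ‖x‖ ^ 2) * ‖gradient F x - gradient G x‖ *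
        rexp (-β * G x)) *
        ∫ w : EuclideanSpace ℝ (Fin d), (1 + ‖w‖ ^ 2) ^ 2 * rexp (-c * ‖w‖ ^ 2))) := by
  have hL : 0 ≤ L := by
    have h0 := (abs_nonneg _).trans (hh 0)
    simpa using h0
  have hFc := hF.continuous
  have hGc := hG.continuous
  have hω := integrable_exp_neg_mul_norm_sq (d := d) hA
  have hωφ : Integrable fun z => rexp (-A * ‖z‖ ^ 2) * rexp (β * (F z - G z)) := by
    refine (hGi.const_mul (rexp (β * F 0) * K)).mono' (by fun_prop) (ae_of_all _ fun z => ?_)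
    have h1 := hkey (π / 2) (0, z) (by simp)
    simp only [ContinuousLinearMap.rotation_apply, Real.cos_pi_div_two, Real.sin_pi_div_two,
      zero_smul, one_smul, zero_add, smul_zero, add_zero, norm_zero, ne_eq, OfNat.ofNat_ne_zero,
      not_false_eq_true, zero_pow, mul_zero, Real.exp_zero, mul_one] at h1
    rw [Real.norm_of_nonneg (by positivity)]
    calc rexp (-A * ‖z‖ ^ 2) * rexp (β * (F z - G z))
        = rexp (β * F 0) * (rexp (β * (F z - F 0)) * rexp (-A * ‖z‖ ^ 2)) * rexp (-β * G z) := by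
          simp only [← Real.exp_add]
          congr 1
          ring
      _ ≤ rexp (β * F 0) * K * rexp (-β * G z) := by gcongr
  have hJ := integrable_sq_mul_exp_neg_mul_norm_sq (d := d) hc
  have hB : Integrable (comparisonBound β c F G) := hD.mul_prod hJ
  have hsplit : ∀ p : EuclideanSpace ℝ (Fin d) × EuclideanSpace ℝ (Fin d),
      h p.1 * rexp (-β * F p.1) * rexp (-A * ‖p.2‖ ^ 2) *
        (rexp (β * (F p.1 - G p.1)) - rexp (β * (F p.2 - G p.2))) =
      h p.1 * rexp (-β * G p.1) * rexp (-A * ‖p.2‖ ^ 2) -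
        h p.1 * rexp (-β * F p.1) * (rexp (-A * ‖p.2‖ ^ 2) * rexp (β * (F p.2 - G p.2))) := by
    intro p
    have : rexp (-β * G p.1) = rexp (-β * F p.1) * rexp (β * (F p.1 - G p.1)) := by
      rw [← Real.exp_add]
      congr 1
      ring
    rw [this]
    ring
  have hint : ∫ p : EuclideanSpace ℝ (Fin d) × EuclideanSpace ℝ (Fin d),
      h p.1 * rexp (-β * F p.1) * rexp (-A * ‖p.2‖ ^ 2) *
        (rexp (β * (F p.1 - G p.1)) - rexp (β * (F p.2 - G p.2))) =
      (∫ x, h x * rexp (-β * G x)) * ∫ z : EuclideanSpace ℝ (Fin d), rexp (-A * ‖z‖ ^ 2) := by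
    simp_rw [hsplit]
    rw [Measure.volume_eq_prod, integral_sub (hhG.mul_prod hω) (hhF.mul_prod hωφ),
      integral_prod_mul (fun x => h x * rexp (-β * G x)) (fun z => rexp (-A * ‖z‖ ^ 2)),
      integral_prod_mul (fun x => h x * rexp (-β * F x))
        (fun z => rexp (-A * ‖z‖ ^ 2) * rexp (β * (F z - G z))), hhF0, zero_mul, sub_zero]
  have hmain := abs_integral_le_of_le_integral_rotation
    (g := fun p => β * L * K * comparisonBound β c F G p)
    (continuous_const.mul (continuous_comparisonBound hF hG))
    (fun p => mul_nonneg (by positivity) (comparisonBound_nonneg p)) (hB.const_mul (β * L * K))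
    (fun p => abs_mul_sub_le_integral_rotation hF hG hβ hK hh p fun θ => hkey θ p)
  rw [hint, abs_mul, mul_comm, abs_of_pos (integral_exp_neg_mul_norm_sq_pos hA),
    integral_const_mul] at hmain
  refine hmain.trans_eq ?_
  congr 2
  exact integral_prod_mul (fun x => (1 + ‖x‖ ^ 2) * ‖gradient F x - gradient G x‖ *
    rexp (-β * G x)) (fun w => (1 + ‖w‖ ^ 2) ^ 2 * rexp (-c * ‖w‖ ^ 2))

end Comparison

section Main

variable {d : ℕ} {F G H : EuclideanSpace ℝ (Fin d) → ℝ} {m b M a β : ℝ}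

lemma integral_mul_gibbsDensity (f : EuclideanSpace ℝ (Fin d) → ℝ) :
    ∫ x, f x * gibbsDensity d β F x = (∫ x, f x * rexp (-β * F x)) / ∫ y, rexp (-β * F y) := by
  simp only [gibbsDensity, mul_div_assoc']
  exact integral_div _ _

lemma integrable_mul_exp_of_mul_gibbsDensity {f : EuclideanSpace ℝ (Fin d) → ℝ}
    (hZ : 0 < ∫ y, rexp (-β * F y)) (hf : Integrable fun x => f x * gibbsDensity d β F x) :
    Integrable fun x => f x * rexp (-β * F x) := by
  refine (hf.mul_const (∫ y, rexp (-β * F y))).congr (ae_of_all _ fun x => ?_)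
  simp only [gibbsDensity]
  rw [mul_assoc, div_mul_cancel₀ _ hZ.ne']

lemma integral_mul_mul_le_sqrt_mul_sqrt {α : Type*} [MeasurableSpace α] {μ : Measure α}
    {f g p : α → ℝ} (hf : ∀ x, 0 ≤ f x) (hg : ∀ x, 0 ≤ g x) (hp : ∀ x, 0 ≤ p x)
    (hfm : Measurable f) (hgm : Measurable g) (hpm : Measurable p)
    (hfi : Integrable (fun x => f x ^ 2 * p x) μ) (hgi : Integrable (fun x => g x ^ 2 * p x) μ) :
    ∫ x, f x * g x * p x ∂μ ≤ √(∫ x, f x ^ 2 * p x ∂μ) * √(∫ x, g x ^ 2 * p x ∂μ) := by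
  have hsq : ∀ (k : α → ℝ) x, (k x * √(p x)) ^ 2 = k x ^ 2 * p x := fun k x => by
    rw [mul_pow, Real.sq_sqrt (hp x)]
  have hLp : ∀ k : α → ℝ, Measurable k → Integrable (fun x => k x ^ 2 * p x) μ →
      MemLp (fun x => k x * √(p x)) (ENNReal.ofReal 2) μ := fun k hk hki => by
    rw [ENNReal.ofReal_ofNat, memLp_two_iff_integrable_sq (by fun_prop)]
    simpa only [hsq] using hki
  have h := integral_mul_le_Lp_mul_Lq_of_nonneg (μ := μ) Real.HolderConjugate.two_two
    (ae_of_all _ fun x => mul_nonneg (hf x) (Real.sqrt_nonneg (p x)))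
    (ae_of_all _ fun x => mul_nonneg (hg x) (Real.sqrt_nonneg (p x)))
    (hLp f hfm hfi) (hLp g hgm hgi)
  simp only [Real.rpow_two, hsq, ← Real.sqrt_eq_rpow] at h
  refine le_of_eq_of_le (integral_congr_ae (ae_of_all _ fun x => ?_)) h
  have := Real.mul_self_sqrt (hp x)
  linear_combination (-(f x * g x)) * this

lemma abs_sub_apply_zero_le {M' aH : ℝ} (hM' : 0 < M') (hH : ContDiff ℝ 1 H) (hs : LSmooth d M' H)
    (h0 : ‖gradient H 0‖ ≤ aH) (x : EuclideanSpace ℝ (Fin d)) :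
    |H x - H 0| ≤ (aH + M') * (1 + ‖x‖ ^ 2) := by
  have h := abs_sub_le_of_lSmooth hM'.le hH hs 0 x
  rw [sub_zero] at h
  have h1 : ‖gradient H 0‖ * ‖x‖ ≤ aH * ‖x‖ := by gcongr
  have ha : 0 ≤ aH := (norm_nonneg _).trans h0
  nlinarith [mul_nonneg ha (sq_nonneg (‖x‖ - 1)), mul_nonneg ha (sq_nonneg ‖x‖)]

set_option maxHeartbeats 800000 in
lemma exists_abs_integral_gibbs_sub_le (d : ℕ) {M' aH : ℝ} (hm : 0 < m) (hb : 0 < b) (hM : 0 < M)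
    (hM' : 0 < M') (hβ : 0 < β) (ha : 0 ≤ a) (haH : 0 ≤ aH) :
    ∃ C₀ : ℝ, 0 < C₀ ∧ ∀ F G H : EuclideanSpace ℝ (Fin d) → ℝ,
      Potential d m b M a F → Potential d m b M a G → ContDiff ℝ 1 H → LSmooth d M' H →
      ‖gradient H 0‖ ≤ aH →
      |(∫ x, H x ∂(gibbs d β F)) - ∫ x, H x ∂(gibbs d β G)| ≤
        C₀ * √(∫ x, ‖gradient F x - gradient G x‖ ^ 2 ∂(gibbs d β G)) := by
  obtain ⟨K, hK0, hK⟩ := exists_gibbsDensity_le d a hm hb hM hβ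
  set J := ∫ x : EuclideanSpace ℝ (Fin d), (1 + ‖x‖ ^ 2) ^ 2 * rexp (-(β * m / 8) * ‖x‖ ^ 2)
  set J' := ∫ x : EuclideanSpace ℝ (Fin d), (1 + ‖x‖ ^ 2) ^ 2 * rexp (-(β * m / 64) * ‖x‖ ^ 2)
  set A := β * (8 * M ^ 2 / m + M + 1 + m / 32)
  have hA0 : 0 < A := by positivity
  set Ω := ∫ z : EuclideanSpace ℝ (Fin d), rexp (-A * ‖z‖ ^ 2)
  have hΩ : 0 < Ω := integral_exp_neg_mul_norm_sq_pos hA0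
  set K' := rexp (β * (2 * (a + (M + m) * √(2 * b / m)) ^ 2 / m + a ^ 2))
  set L := (aH + M') * (1 + K * J) with hL
  have hJ0 : 0 ≤ J := integral_nonneg fun x => by positivity
  have hJ'0 : 0 ≤ J' := integral_nonneg fun x => by positivity
  have hL0 : 0 ≤ L := by positivity
  set C := Ω⁻¹ * (π / 2 * (β * L * K' * J') * √(1 * K * J)) with hC
  have hC0 : 0 ≤ C := by positivity
  refine ⟨C + 1, by positivity, fun F G H hF hG hH hHs hH0 => ?_⟩
  have hFc := hF.contDiff.continuous
  have hGc := hG.contDiff.continuous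
  have hHc := hH.continuous
  have hDc : Continuous fun x => ‖gradient F x - gradient G x‖ :=
    ((continuous_gradient_of_contDiff hF.contDiff).sub
      (continuous_gradient_of_contDiff hG.contDiff)).norm
  have hpG := continuous_gibbsDensity (β := β) hGc
  have hquad : ∀ x : EuclideanSpace ℝ (Fin d), 1 + ‖x‖ ^ 2 ≤ (1 + ‖x‖ ^ 2) ^ 2 := fun x => by
    nlinarith [sq_nonneg ‖x‖, sq_nonneg (‖x‖ ^ 2)]
  have hHquad : ∀ x, |H x| ≤ (|H 0| + (aH + M')) * (1 + ‖x‖ ^ 2) ^ 2 := fun x => by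
    have h1 := abs_sub_apply_zero_le hM' hH hHs hH0 x
    have h2 : |H x| ≤ |H 0| + |H x - H 0| := by
      simpa using abs_add_le (H 0) (H x - H 0)
    have h3 : |H 0| * 1 ≤ |H 0| * (1 + ‖x‖ ^ 2) ^ 2 := by
      gcongr
      nlinarith [hquad x, sq_nonneg ‖x‖]
    have h4 := mul_le_mul_of_nonneg_left (hquad x) (by positivity : 0 ≤ aH + M')
    linarith
  have hone : ∀ x : EuclideanSpace ℝ (Fin d), |(1 : ℝ)| ≤ 1 * (1 + ‖x‖ ^ 2) ^ 2 := fun x => by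
    rw [abs_one, one_mul]
    nlinarith [hquad x, sq_nonneg ‖x‖]
  have hHF := integrable_mul_gibbsDensity hm hβ hFc (hK F hF) hHc hHquad
  have hHG := integrable_mul_gibbsDensity hm hβ hGc (hK G hG) hHc hHquad
  have h1F := integrable_mul_gibbsDensity hm hβ hFc (hK F hF) continuous_const hone
  have h1G := integrable_mul_gibbsDensity hm hβ hGc (hK G hG) continuous_const hone
  have hIF := hF.integral_gibbsDensity hm hb hM hβ
  have hIG := hG.integral_gibbsDensity hm hb hM hβ
  have hZF := integral_exp_pos (hF.integrable_exp hm hb hM hβ)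
  have hZG := integral_exp_pos (hG.integrable_exp hm hb hM hβ)
  set e := ∫ x, H x * gibbsDensity d β F x with he
  have hpF1 : Integrable fun x => gibbsDensity d β F x := by simpa using h1F.1
  have hpG1 : Integrable fun x => gibbsDensity d β G x := by simpa using h1G.1
  have hcenter : |H 0 - e| ≤ (aH + M') * K * J := by
    have h := (integrable_mul_gibbsDensity (L := aH + M') hm hβ hFc (hK F hF)
      (hHc.sub continuous_const) (f := fun x => H x - H 0) fun x =>
      (abs_sub_apply_zero_le hM' hH hHs hH0 x).trans
        (mul_le_mul_of_nonneg_left (hquad x) (by positivity))).2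
    simp only [sub_mul] at h
    rw [integral_sub hHF.1 (hpF1.const_mul _),
      integral_const_mul, hIF, mul_one, abs_sub_comm] at h
    exact h
  have hh : ∀ x, |H x - e| ≤ L * (1 + ‖x‖ ^ 2) := fun x => by
    have h1 := abs_sub_apply_zero_le hM' hH hHs hH0 x
    have h2 : |H x - e| ≤ |H x - H 0| + |H 0 - e| := abs_sub_le _ _ _
    have h3 : 0 ≤ (aH + M') * K * J * ‖x‖ ^ 2 := by positivity
    rw [hL]
    linarith
  have hhF : Integrable fun x => (H x - e) * gibbsDensity d β F x := by
    simp only [sub_mul]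
    exact hHF.1.sub (hpF1.const_mul e)
  have hhG : Integrable fun x => (H x - e) * gibbsDensity d β G x := by
    simp only [sub_mul]
    exact hHG.1.sub (hpG1.const_mul e)
  have hhF0 : ∫ x, (H x - e) * gibbsDensity d β F x = 0 := by
    simp only [sub_mul]
    rw [integral_sub hHF.1 (hpF1.const_mul e), integral_const_mul, hIF, ← he]
    ring
  have hhG0 : ∫ x, (H x - e) * gibbsDensity d β G x =
      (∫ x, H x * gibbsDensity d β G x) - e := by
    simp only [sub_mul]
    rw [integral_sub hHG.1 (hpG1.const_mul e), integral_const_mul, hIG, mul_one]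
  have hDle : ∀ x, ‖gradient F x - gradient G x‖ ≤ (2 * a + 2 * M) * (1 + ‖x‖ ^ 2) := fun x => by
    have h1 := norm_sub_le (gradient F x) (gradient G x)
    have h2 := hF.norm_gradient_le x
    have h3 := hG.norm_gradient_le x
    have h4 : M * ‖x‖ ≤ M * (1 + ‖x‖ ^ 2) := by
      gcongr
      nlinarith [sq_nonneg (‖x‖ - 1)]
    have h5 : 0 ≤ a * ‖x‖ ^ 2 := by positivity
    linarith
  have hD1 : Integrable fun x =>
      (1 + ‖x‖ ^ 2) * ‖gradient F x - gradient G x‖ * gibbsDensity d β G x := by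
    refine (integrable_mul_gibbsDensity (L := 2 * a + 2 * M) hm hβ hGc (hK G hG)
      (f := fun x => (1 + ‖x‖ ^ 2) * ‖gradient F x - gradient G x‖)
      ((by fun_prop : Continuous fun x : EuclideanSpace ℝ (Fin d) => 1 + ‖x‖ ^ 2).mul hDc)
      fun x => ?_).1
    rw [abs_of_nonneg (by positivity)]
    calc _ ≤ (1 + ‖x‖ ^ 2) * ((2 * a + 2 * M) * (1 + ‖x‖ ^ 2)) := by
          gcongr
          exact hDle x
      _ = _ := by ring
  have hD2 : Integrable fun x =>
      ‖gradient F x - gradient G x‖ ^ 2 * gibbsDensity d β G x := by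
    refine (integrable_mul_gibbsDensity (L := (2 * a + 2 * M) ^ 2) hm hβ hGc (hK G hG)
      (f := fun x => ‖gradient F x - gradient G x‖ ^ 2) (hDc.pow 2) fun x => ?_).1
    rw [abs_of_nonneg (by positivity), ← mul_pow]
    exact pow_le_pow_left₀ (norm_nonneg _) (hDle x) 2
  have hq2 := integrable_mul_gibbsDensity (L := 1) hm hβ hGc (hK G hG)
    (f := fun x => (1 + ‖x‖ ^ 2) ^ 2) (by fun_prop) fun x => by
      rw [abs_of_nonneg (by positivity), one_mul]
  have hmain := abs_integral_mul_exp_le hF.contDiff hG.contDiff hβ.le (K := K') (A := A)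
    (c := β * m / 64) (by positivity) (by positivity) hA0 hh
    (fun θ p hθ => hF.exp_rotation_le hm hb hM hβ hθ p)
    (integrable_mul_exp_of_mul_gibbsDensity hZF hhF)
    (by
      rw [integral_mul_gibbsDensity, div_eq_zero_iff] at hhF0
      exact hhF0.resolve_right hZF.ne')
    (integrable_mul_exp_of_mul_gibbsDensity hZG hhG) (hG.integrable_exp hm hb hM hβ)
    (integrable_mul_exp_of_mul_gibbsDensity hZG hD1)
  have hCS := integral_mul_mul_le_sqrt_mul_sqrt (f := fun x => 1 + ‖x‖ ^ 2)
    (g := fun x => ‖gradient F x - gradient G x‖) (p := gibbsDensity d β G) (μ := volume)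
    (fun x => by positivity) (fun x => norm_nonneg _) gibbsDensity_nonneg (by fun_prop)
    hDc.measurable hpG.measurable hq2.1 hD2
  rw [integral_gibbs hFc, integral_gibbs hGc, integral_gibbs hGc, ← he, abs_sub_comm, ← hhG0]
  set S := √(∫ x, ‖gradient F x - gradient G x‖ ^ 2 * gibbsDensity d β G x)
  have hS : 0 ≤ S := Real.sqrt_nonneg _
  have hnorm : Ω * |∫ x, (H x - e) * gibbsDensity d β G x| ≤
      π / 2 * (β * L * K' * ((∫ x, (1 + ‖x‖ ^ 2) * ‖gradient F x - gradient G x‖ *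
        gibbsDensity d β G x) * J')) := by
    rw [integral_mul_gibbsDensity, integral_mul_gibbsDensity, abs_div, abs_of_pos hZG]
    have h := div_le_div_of_nonneg_right hmain hZG.le
    refine le_of_eq_of_le ?_ (h.trans_eq ?_) <;> ring
  have hmoment : √(∫ x, (1 + ‖x‖ ^ 2) ^ 2 * gibbsDensity d β G x) ≤ √(1 * K * J) :=
    Real.sqrt_le_sqrt ((le_abs_self _).trans hq2.2)
  calc |∫ x, (H x - e) * gibbsDensity d β G x|
      = Ω⁻¹ * (Ω * |∫ x, (H x - e) * gibbsDensity d β G x|) := by field_simp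
    _ ≤ Ω⁻¹ * (π / 2 * (β * L * K' * ((√(1 * K * J) * S) * J'))) := by
        refine mul_le_mul_of_nonneg_left (hnorm.trans ?_) (by positivity)
        gcongr
        exact hCS.trans (by gcongr)
    _ = C * S := by rw [hC]; ring
    _ ≤ (C + 1) * S := by linarith

end Main

theorem stmt0 (d : ℕ) (hd : 1 ≤ d) (m b M M' β : ℝ)
    (hm : 0 < m) (hb : 0 < b) (hM : 0 < M) (hM' : 0 < M') (hβ : 0 < β)
    (aH aF aG : ℝ) :
    ∃ C₀ : ℝ, 0 < C₀ ∧
      ∀ F G H : EuclideanSpace ℝ (Fin d) → ℝ,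
        ContDiff ℝ 1 F → ContDiff ℝ 1 G → ContDiff ℝ 1 H →
        (∀ x, 0 ≤ F x) → (∀ x, 0 ≤ G x) →
        Dissipative d m b F → Dissipative d m b G →
        LSmooth d M F → LSmooth d M G → LSmooth d M' H →
        ‖gradient H 0‖ = aH → ‖gradient F 0‖ = aF → ‖gradient G 0‖ = aG →
        |(∫ x, H x ∂(gibbs d β F)) - ∫ x, H x ∂(gibbs d β G)| ≤
          C₀ * Real.sqrt (∫ x, ‖gradient F x - gradient G x‖ ^ 2 ∂(gibbs d β G)) := by
  obtain ⟨C₀, hC₀, h⟩ := exists_abs_integral_gibbs_sub_le (a := |aF| + |aG|) (aH := |aH|)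
    d hm hb hM hM' hβ (by positivity) (abs_nonneg _)
  refine ⟨C₀, hC₀, fun F G H hF hG hH _ _ hFd hGd hFs hGs hHs hH0 hF0 hG0 => ?_⟩
  refine h F G H ⟨hF, hFd, hFs, ?_⟩ ⟨hG, hGd, hGs, ?_⟩ hH hHs (hH0.trans_le (le_abs_self _))
  · linarith [le_abs_self aF, abs_nonneg aG]
  · linarith [le_abs_self aG, abs_nonneg aF]

end
end

section
/- Let d ≥ 1 be an integer and m, b, M, β > 0, and let H ∈ C¹(ℝ^d;ℝ) be M-smooth. Then there exists a constant C₀ > 0 depending only on (m, b, M, β, ‖∇H(0)‖, d) such that for all probability measures μ, ν on ℝ^d with finite second moments, |∫_{ℝ^d} H dμ − ∫_{ℝ^d} H dν| ≤ C₀ · W_{ρ₂}(μ, ν). -/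
open MeasureTheory Real RealInnerProductSpace

noncomputable section

def Vbar {d : ℕ} (x : EuclideanSpace ℝ (Fin d)) : ℝ := 1 + ‖x‖ ^ 2

def Cc (d : ℕ) (m b β : ℝ) : ℝ := 2 * ((d : ℝ) / β + b) + m

def S1 (d : ℕ) (m b β : ℝ) : Set (EuclideanSpace ℝ (Fin d) × EuclideanSpace ℝ (Fin d)) :=
  {p | Vbar p.1 + Vbar p.2 ≤ 2 * Cc d m b β / m}

def S2 (d : ℕ) (m b β : ℝ) : Set (EuclideanSpace ℝ (Fin d) × EuclideanSpace ℝ (Fin d)) :=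
  {p | Vbar p.1 + Vbar p.2 ≤ 4 * Cc d m b β * (1 + 1 / m)}

def R1 (d : ℕ) (m b β : ℝ) : ℝ := Metric.diam (S1 d m b β)

def R2 (d : ℕ) (m b β : ℝ) : ℝ := Metric.diam (S2 d m b β)

def kappa (d : ℕ) (m b M β : ℝ) : ℝ :=
  min (1 / 2)
    (2 / (Cc d m b β * β * (Real.exp (2 * R1 d m b β) - 1 - 2 * R1 d m b β)) *
      Real.exp (-(M * β * R1 d m b β ^ 2 / 8)))

def Qk (d : ℕ) (m b M β : ℝ) : ℝ :=
  2 * Real.sqrt (kappa d m b M β - kappa d m b M β ^ 2)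

def phi (d : ℕ) (m b M β : ℝ) (r : ℝ) : ℝ :=
  Real.exp (-(M * β / 8) * r ^ 2 - 2 * Qk d m b M β * r)

def Phi (d : ℕ) (m b M β : ℝ) (r : ℝ) : ℝ :=
  ∫ s in (0:ℝ)..r, phi d m b M β s

def zeta (d : ℕ) (m b M β : ℝ) : ℝ :=
  (∫ s in (0:ℝ)..(R2 d m b β), Phi d m b M β s * (phi d m b M β s)⁻¹)⁻¹

def xi (d : ℕ) (m b M β : ℝ) : ℝ :=
  (∫ s in (0:ℝ)..(R1 d m b β), Phi d m b M β s * (phi d m b M β s)⁻¹)⁻¹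

def gfun (d : ℕ) (m b M β : ℝ) (r : ℝ) : ℝ :=
  1 - zeta d m b M β / 4 *
      (∫ s in (0:ℝ)..(min r (R2 d m b β)), Phi d m b M β s * (phi d m b M β s)⁻¹)
    - xi d m b M β / 4 *
      (∫ s in (0:ℝ)..(min r (R1 d m b β)), Phi d m b M β s * (phi d m b M β s)⁻¹)

def ffun (d : ℕ) (m b M β : ℝ) (r : ℝ) : ℝ :=
  if r < 0 then r else ∫ s in (0:ℝ)..(min r (R2 d m b β)), phi d m b M β s * gfun d m b M β s

def Ufun (d : ℕ) (m b M β : ℝ) (x y : EuclideanSpace ℝ (Fin d)) : ℝ :=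
  1 + kappa d m b M β * Vbar x + kappa d m b M β * Vbar y

def rho2 (d : ℕ) (m b M β : ℝ) (x y : EuclideanSpace ℝ (Fin d)) : ℝ :=
  ffun d m b M β ‖x - y‖ * Ufun d m b M β x y

def Wrho2 (d : ℕ) (m b M β : ℝ) (μ ν : Measure (EuclideanSpace ℝ (Fin d))) : ℝ :=
  ⨅ γ : {γ : Measure (EuclideanSpace ℝ (Fin d) × EuclideanSpace ℝ (Fin d)) //
      IsProbabilityMeasure γ ∧ γ.map Prod.fst = μ ∧ γ.map Prod.snd = ν},
    ∫ p, rho2 d m b M β p.1 p.2 ∂γ.1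

section Helpers

variable {d : ℕ} {m b M β : ℝ}

theorem continuous_phi : Continuous (phi d m b M β) := by
  unfold phi; fun_prop

theorem phi_pos (r : ℝ) : 0 < phi d m b M β r := Real.exp_pos _

theorem continuous_Phi : Continuous (Phi d m b M β) :=
  intervalIntegral.continuous_primitive
    (fun _ _ => continuous_phi.intervalIntegrable _ _) _

theorem continuous_Phi_mul_inv_phi :
    Continuous fun s => Phi d m b M β s * (phi d m b M β s)⁻¹ :=
  continuous_Phi.mul (continuous_phi.inv₀ fun r => (phi_pos r).ne')

theorem Phi_mul_inv_phi_nonneg {s : ℝ} (hs : 0 ≤ s) :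
    0 ≤ Phi d m b M β s * (phi d m b M β s)⁻¹ :=
  mul_nonneg (intervalIntegral.integral_nonneg hs fun u _ => (phi_pos u).le)
    (inv_nonneg.2 (phi_pos s).le)

theorem continuous_gfun : Continuous (gfun d m b M β) := by
  have h : Continuous fun r => ∫ s in (0:ℝ)..r, Phi d m b M β s * (phi d m b M β s)⁻¹ :=
    intervalIntegral.continuous_primitive
      (fun _ _ => continuous_Phi_mul_inv_phi.intervalIntegrable _ _) _
  have h₁ := h.comp (continuous_id.min (continuous_const (y := R1 d m b β)))
  have h₂ := h.comp (continuous_id.min (continuous_const (y := R2 d m b β)))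
  exact (continuous_const.sub (continuous_const.mul h₂)).sub (continuous_const.mul h₁)

theorem inv_integral_div_four_mul_integral_min_le {h : ℝ → ℝ} (hc : Continuous h)
    (h0 : ∀ s, 0 ≤ s → 0 ≤ h s) {r R : ℝ} (hr : 0 ≤ r) (hR : 0 ≤ R) :
    (∫ s in (0:ℝ)..R, h s)⁻¹ / 4 * (∫ s in (0:ℝ)..(min r R), h s) ≤ 1 / 4 := by
  have h₁ : (∫ s in (0:ℝ)..(min r R), h s) ≤ ∫ s in (0:ℝ)..R, h s := by
    refine intervalIntegral.integral_mono_interval le_rfl (le_min hr hR) (min_le_right _ _) ?_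
      (hc.intervalIntegrable _ _)
    filter_upwards [ae_restrict_mem measurableSet_Ioc] with s hs using h0 s hs.1.le
  have h₂ : 0 ≤ ∫ s in (0:ℝ)..R, h s :=
    intervalIntegral.integral_nonneg hR fun s hs => h0 s hs.1
  calc _ ≤ (∫ s in (0:ℝ)..R, h s)⁻¹ / 4 * ∫ s in (0:ℝ)..R, h s := by gcongr
    _ = ((∫ s in (0:ℝ)..R, h s)⁻¹ * ∫ s in (0:ℝ)..R, h s) / 4 := by ring
    _ ≤ 1 / 4 := by gcongr; exact inv_mul_le_one

theorem half_le_gfun {r : ℝ} (hr : 0 ≤ r) : 1 / 2 ≤ gfun d m b M β r := by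
  have h₁ := inv_integral_div_four_mul_integral_min_le
    (continuous_Phi_mul_inv_phi (d := d) (m := m) (b := b) (M := M) (β := β))
    (fun s hs => Phi_mul_inv_phi_nonneg hs) hr (Metric.diam_nonneg (s := S1 d m b β))
  have h₂ := inv_integral_div_four_mul_integral_min_le
    (continuous_Phi_mul_inv_phi (d := d) (m := m) (b := b) (M := M) (β := β))
    (fun s hs => Phi_mul_inv_phi_nonneg hs) hr (Metric.diam_nonneg (s := S2 d m b β))
  unfold gfun zeta xi R1 R2
  linarith

theorem ffun_of_nonneg {r : ℝ} (hr : 0 ≤ r) :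
    ffun d m b M β r =
      ∫ s in (0:ℝ)..(min r (R2 d m b β)), phi d m b M β s * gfun d m b M β s :=
  if_neg hr.not_gt

theorem le_phi (hM : 0 < M) (hβ : 0 < β) {s R : ℝ} (hs : 0 ≤ s) (hsR : s ≤ R) :
    phi d m b M β R ≤ phi d m b M β s := by
  have hQ : 0 ≤ Qk d m b M β := by unfold Qk; positivity
  unfold phi
  refine Real.exp_le_exp.2 ?_
  have h₁ : M * β / 8 * s ^ 2 ≤ M * β / 8 * R ^ 2 := by gcongr
  have h₂ : 2 * Qk d m b M β * s ≤ 2 * Qk d m b M β * R := by gcongr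
  linarith

theorem mul_min_le_ffun (hM : 0 < M) (hβ : 0 < β) {r : ℝ} (hr : 0 ≤ r) :
    phi d m b M β (R2 d m b β) / 2 * min r (R2 d m b β) ≤ ffun d m b M β r := by
  have hR : 0 ≤ R2 d m b β := Metric.diam_nonneg
  rw [ffun_of_nonneg hr]
  have h : (∫ _ in (0:ℝ)..(min r (R2 d m b β)), phi d m b M β (R2 d m b β) / 2) ≤
      ∫ s in (0:ℝ)..(min r (R2 d m b β)), phi d m b M β s * gfun d m b M β s := by
    refine intervalIntegral.integral_mono_on (le_min hr hR) (by simp)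
      ((continuous_phi.mul continuous_gfun).intervalIntegrable _ _) fun s hs => ?_
    rw [div_eq_mul_one_div]
    exact mul_le_mul (le_phi hM hβ hs.1 (hs.2.trans (min_le_right _ _))) (half_le_gfun hs.1)
      (by norm_num) (phi_pos s).le
  rw [intervalIntegral.integral_const, sub_zero, smul_eq_mul] at h
  linarith

theorem continuous_ffun_norm {E : Type*} [SeminormedAddCommGroup E] :
    Continuous fun z : E => ffun d m b M β ‖z‖ := by
  simp_rw [ffun_of_nonneg (norm_nonneg _)]
  exact (intervalIntegral.continuous_primitive
    (fun _ _ => (continuous_phi.mul continuous_gfun).intervalIntegrable _ _) 0).comp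
    (continuous_norm.min continuous_const)

theorem exists_abs_ffun_le : ∃ B, ∀ r, 0 ≤ r → |ffun d m b M β r| ≤ B := by
  have hc : Continuous fun r => ∫ s in (0:ℝ)..r, phi d m b M β s * gfun d m b M β s :=
    intervalIntegral.continuous_primitive
      (fun _ _ => (continuous_phi.mul continuous_gfun).intervalIntegrable _ _) 0
  obtain ⟨B, hB⟩ := (isCompact_Icc (a := 0) (b := R2 d m b β)).exists_bound_of_continuousOn
    hc.continuousOn
  refine ⟨B, fun r hr => ?_⟩
  rw [ffun_of_nonneg hr]
  exact hB _ ⟨le_min hr Metric.diam_nonneg, min_le_right _ _⟩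

theorem diam_setOf_Vbar_add_le_pos (hd : 1 ≤ d) {K : ℝ} (hK : 2 < K) :
    0 < Metric.diam {p : EuclideanSpace ℝ (Fin d) × EuclideanSpace ℝ (Fin d) |
      Vbar p.1 + Vbar p.2 ≤ K} := by
  set S := {p : EuclideanSpace ℝ (Fin d) × EuclideanSpace ℝ (Fin d) | Vbar p.1 + Vbar p.2 ≤ K}
  have hbd : Bornology.IsBounded S := by
    refine (Metric.isBounded_closedBall (x := 0) (r := K)).subset fun p hp => ?_
    have hp' : 1 + ‖p.1‖ ^ 2 + (1 + ‖p.2‖ ^ 2) ≤ K := hp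
    rw [mem_closedBall_zero_iff, Prod.norm_def]
    exact max_le (by nlinarith [sq_nonneg (‖p.1‖ - 1), sq_nonneg ‖p.2‖])
      (by nlinarith [sq_nonneg (‖p.2‖ - 1), sq_nonneg ‖p.1‖])
  have hs : 0 < √(K - 2) := Real.sqrt_pos.2 (by linarith)
  set v : EuclideanSpace ℝ (Fin d) := EuclideanSpace.single ⟨0, hd⟩ √(K - 2)
  have hv : ‖v‖ = √(K - 2) := by simp [v]
  have h0 : ((0 : EuclideanSpace ℝ (Fin d)), (0 : EuclideanSpace ℝ (Fin d))) ∈ S := by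
    change 1 + ‖(0 : EuclideanSpace ℝ (Fin d))‖ ^ 2 +
      (1 + ‖(0 : EuclideanSpace ℝ (Fin d))‖ ^ 2) ≤ K
    simp; linarith
  have h1 : (v, (0 : EuclideanSpace ℝ (Fin d))) ∈ S := by
    change 1 + ‖v‖ ^ 2 + (1 + ‖(0 : EuclideanSpace ℝ (Fin d))‖ ^ 2) ≤ K
    rw [hv, Real.sq_sqrt (by linarith)]
    simp; linarith
  have h := Metric.dist_le_diam_of_mem hbd h1 h0
  rw [Prod.dist_eq] at h
  have h' := (le_max_left _ _).trans h
  simp only [dist_zero_right] at h'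
  linarith

theorem lt_Cc (hb : 0 < b) (hβ : 0 < β) : m < Cc d m b β := by
  have : 0 < 2 * ((d : ℝ) / β + b) := by positivity
  unfold Cc; linarith

theorem R1_pos (hd : 1 ≤ d) (hm : 0 < m) (hb : 0 < b) (hβ : 0 < β) : 0 < R1 d m b β := by
  refine diam_setOf_Vbar_add_le_pos hd ?_
  rw [lt_div_iff₀ hm]
  linarith [lt_Cc (d := d) (m := m) hb hβ]

theorem R2_pos (hd : 1 ≤ d) (hm : 0 < m) (hb : 0 < b) (hβ : 0 < β) : 0 < R2 d m b β := by
  refine diam_setOf_Vbar_add_le_pos hd ?_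
  have h := lt_Cc (d := d) (m := m) hb hβ
  calc (2 : ℝ) < 4 * m * (1 + 1 / m) := by field_simp; linarith
    _ ≤ _ := by gcongr

theorem kappa_pos (hd : 1 ≤ d) (hm : 0 < m) (hb : 0 < b) (hβ : 0 < β) :
    0 < kappa d m b M β := by
  have hR := R1_pos hd hm hb hβ
  have hC := hm.trans (lt_Cc (d := d) hb hβ)
  have he : 0 < Real.exp (2 * R1 d m b β) - 1 - 2 * R1 d m b β := by
    linarith [Real.add_one_lt_exp (x := 2 * R1 d m b β) (by positivity)]
  exact lt_min (by norm_num) (by positivity)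

/-- A function with Lipschitz gradient is locally Lipschitz with an affine constant. -/
theorem LSmooth.abs_sub_le {H : EuclideanSpace ℝ (Fin d) → ℝ} (hH : ContDiff ℝ 1 H)
    (hM : 0 ≤ M) (hL : LSmooth d M H) (x y : EuclideanSpace ℝ (Fin d)) :
    |H x - H y| ≤ (‖gradient H 0‖ + M * (‖x‖ + ‖y‖)) * ‖x - y‖ := by
  refine (convex_closedBall (0 : EuclideanSpace ℝ (Fin d))
    (‖x‖ + ‖y‖)).norm_image_sub_le_of_norm_fderiv_le (𝕜 := ℝ)
    (fun z _ => hH.differentiable (by simp) z) (fun z hz => ?_) (by simp) (by simp)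
  have h₁ : ‖fderiv ℝ H z‖ = ‖gradient H z‖ := by simp [gradient]
  have h₂ := hL z 0
  have h₃ := norm_le_norm_add_norm_sub' (gradient H z) (gradient H 0)
  rw [sub_zero] at h₂
  rw [mem_closedBall_zero_iff] at hz
  have h₄ : M * ‖z‖ ≤ M * (‖x‖ + ‖y‖) := by gcongr
  linarith

theorem LSmooth.abs_sub_le_quadratic {H : EuclideanSpace ℝ (Fin d) → ℝ} (hH : ContDiff ℝ 1 H)
    (hM : 0 ≤ M) (hL : LSmooth d M H) {R : ℝ} (hR : 0 < R) (x y : EuclideanSpace ℝ (Fin d)) :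
    |H x - H y| ≤ (‖gradient H 0‖ + 2 * M) * (1 + 1 / R) * (1 + ‖x‖ ^ 2 + ‖y‖ ^ 2) *
      min ‖x - y‖ R := by
  have h := hL.abs_sub_le hH hM x y
  set a := ‖gradient H 0‖
  set T := 1 + ‖x‖ ^ 2 + ‖y‖ ^ 2
  have ha : 0 ≤ a := norm_nonneg _
  have hs : ‖x‖ + ‖y‖ ≤ T := by
    simp only [T]; nlinarith [sq_nonneg (‖x‖ - 1), sq_nonneg (‖y‖ - 1)]
  have hs2 : (‖x‖ + ‖y‖) ^ 2 ≤ 2 * T := by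
    simp only [T]; nlinarith [sq_nonneg (‖x‖ - ‖y‖)]
  have hT : 1 ≤ T := by simp only [T]; nlinarith [sq_nonneg ‖x‖, sq_nonneg ‖y‖]
  rcases le_total ‖x - y‖ R with hr | hr
  · rw [min_eq_left hr]
    refine h.trans (mul_le_mul_of_nonneg_right ?_ (norm_nonneg _))
    calc a + M * (‖x‖ + ‖y‖) ≤ a * T + 2 * M * T := by nlinarith
      _ = (a + 2 * M) * 1 * T := by ring
      _ ≤ (a + 2 * M) * (1 + 1 / R) * T := by
        gcongr
        linarith [one_div_pos.2 hR]
  · rw [min_eq_right hr]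
    calc |H x - H y| ≤ (a + M * (‖x‖ + ‖y‖)) * (‖x‖ + ‖y‖) :=
          h.trans (by gcongr; exact norm_sub_le x y)
      _ = a * (‖x‖ + ‖y‖) + M * (‖x‖ + ‖y‖) ^ 2 := by ring
      _ ≤ a * T + M * (2 * T) := by gcongr
      _ = (a + 2 * M) * (0 + 1 / R) * T * R := by field_simp; ring
      _ ≤ (a + 2 * M) * (1 + 1 / R) * T * R := by gcongr; norm_num

theorem kappa_mul_le_Ufun (x y : EuclideanSpace ℝ (Fin d)) (hκ : 0 ≤ kappa d m b M β) :
    kappa d m b M β * (1 + ‖x‖ ^ 2 + ‖y‖ ^ 2) ≤ Ufun d m b M β x y := by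
  unfold Ufun Vbar
  nlinarith

theorem LSmooth.abs_sub_le_rho2 (hd : 1 ≤ d) (hm : 0 < m) (hb : 0 < b) (hM : 0 < M)
    (hβ : 0 < β) {H : EuclideanSpace ℝ (Fin d) → ℝ} (hH : ContDiff ℝ 1 H)
    (hL : LSmooth d M H) (x y : EuclideanSpace ℝ (Fin d)) :
    |H x - H y| ≤ (‖gradient H 0‖ + 2 * M) * (1 + 1 / R2 d m b β) /
      (kappa d m b M β * (phi d m b M β (R2 d m b β) / 2)) * rho2 d m b M β x y := by
  have hR := R2_pos hd hm hb hβ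
  have hκ := kappa_pos (M := M) hd hm hb hβ
  have hφ := phi_pos (d := d) (m := m) (b := b) (M := M) (β := β) (R2 d m b β)
  have hf := mul_min_le_ffun (d := d) (m := m) (b := b) hM hβ (norm_nonneg (x - y))
  have hU := kappa_mul_le_Ufun x y hκ.le
  have hmin : 0 ≤ min ‖x - y‖ (R2 d m b β) := le_min (norm_nonneg _) hR.le
  refine (hL.abs_sub_le_quadratic hH hM.le hR x y).trans ?_
  have hfU := mul_le_mul hf hU (by positivity) ((by positivity : (0:ℝ) ≤ _).trans hf)
  rw [div_mul_eq_mul_div, le_div_iff₀ (by positivity)]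
  calc _ = (‖gradient H 0‖ + 2 * M) * (1 + 1 / R2 d m b β) *
        (phi d m b M β (R2 d m b β) / 2 * min ‖x - y‖ (R2 d m b β) *
          (kappa d m b M β * (1 + ‖x‖ ^ 2 + ‖y‖ ^ 2))) := by ring
    _ ≤ _ := by
      unfold rho2
      gcongr

theorem LSmooth.integrable {H : EuclideanSpace ℝ (Fin d) → ℝ} (hH : ContDiff ℝ 1 H)
    (hM : 0 ≤ M) (hL : LSmooth d M H) {μ : Measure (EuclideanSpace ℝ (Fin d))}
    [IsFiniteMeasure μ] (hμ : Integrable (fun x => ‖x‖ ^ 2) μ) : Integrable H μ := by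
  refine Integrable.mono'
    ((integrable_const |H 0|).add
      (((integrable_const 1).add hμ).const_mul ((‖gradient H 0‖ + 2 * M) * 2)))
    hH.continuous.aestronglyMeasurable (ae_of_all _ fun x => ?_)
  have h := hL.abs_sub_le_quadratic hH hM one_pos x 0
  have h' : |H x| ≤ |H 0| + |H x - H 0| := by
    have := abs_add_le (H 0) (H x - H 0); rwa [add_sub_cancel] at this
  refine h'.trans (add_le_add_right (h.trans ?_) _)
  rw [norm_zero, sub_zero]
  calc _ ≤ (‖gradient H 0‖ + 2 * M) * (1 + 1 / 1) * (1 + ‖x‖ ^ 2 + 0 ^ 2) * 1 := by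
        gcongr; exact min_le_right _ _
    _ = _ := by simp only [Pi.add_apply]; ring

theorem integrable_rho2 {γ : Measure (EuclideanSpace ℝ (Fin d) × EuclideanSpace ℝ (Fin d))}
    [IsFiniteMeasure γ] (h₁ : Integrable (fun p => ‖p.1‖ ^ 2) γ)
    (h₂ : Integrable (fun p => ‖p.2‖ ^ 2) γ) :
    Integrable (fun p => rho2 d m b M β p.1 p.2) γ := by
  obtain ⟨B, hB⟩ := exists_abs_ffun_le (d := d) (m := m) (b := b) (M := M) (β := β)
  have hU : Integrable (fun p => Ufun d m b M β p.1 p.2) γ :=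
    ((integrable_const 1).add (((integrable_const 1).add h₁).const_mul _)).add
      (((integrable_const 1).add h₂).const_mul _)
  exact hU.bdd_mul
    (continuous_ffun_norm.comp (continuous_fst.sub continuous_snd)).aestronglyMeasurable
    (ae_of_all _ fun p => hB _ (norm_nonneg (p.1 - p.2)))

/-- A pointwise bound of the increments of `H` by a cost bounds the difference of its integrals
by the cost of any coupling. -/
theorem abs_integral_sub_le_of_coupling {X : Type*} [MeasurableSpace X] {μ ν : Measure X}
    {γ : Measure (X × X)} (hμ : γ.map Prod.fst = μ) (hν : γ.map Prod.snd = ν) {H : X → ℝ}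
    {c : X → X → ℝ} {K : ℝ} (hHμ : Integrable H μ) (hHν : Integrable H ν)
    (hc : Integrable (fun p => c p.1 p.2) γ) (h : ∀ x y, |H x - H y| ≤ K * c x y) :
    |(∫ x, H x ∂μ) - ∫ x, H x ∂ν| ≤ K * ∫ p, c p.1 p.2 ∂γ := by
  subst hμ hν
  rw [integral_map measurable_fst.aemeasurable hHμ.1,
    integral_map measurable_snd.aemeasurable hHν.1,
    ← integral_const_mul]
  have h₁ : Integrable (fun p : X × X => H p.1) γ := hHμ.comp_measurable measurable_fst
  have h₂ : Integrable (fun p : X × X => H p.2) γ := hHν.comp_measurable measurable_snd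
  rw [← integral_sub h₁ h₂, ← Real.norm_eq_abs]
  exact norm_integral_le_of_norm_le (hc.const_mul K) (ae_of_all _ fun p => h p.1 p.2)

end Helpers

theorem stmt2 (d : ℕ) (hd : 1 ≤ d) (m b M β : ℝ)
    (hm : 0 < m) (hb : 0 < b) (hM : 0 < M) (hβ : 0 < β) (aH : ℝ) :
    ∃ C₀ : ℝ, 0 < C₀ ∧
      ∀ H : EuclideanSpace ℝ (Fin d) → ℝ,
        ContDiff ℝ 1 H → LSmooth d M H → ‖gradient H 0‖ = aH →
        ∀ μ ν : Measure (EuclideanSpace ℝ (Fin d)),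
          IsProbabilityMeasure μ → IsProbabilityMeasure ν →
          Integrable (fun x => ‖x‖ ^ 2) μ → Integrable (fun x => ‖x‖ ^ 2) ν →
          |(∫ x, H x ∂μ) - ∫ x, H x ∂ν| ≤ C₀ * Wrho2 d m b M β μ ν := by
  have hR := R2_pos hd hm hb hβ
  have hκ := kappa_pos (M := M) hd hm hb hβ
  have hφ := phi_pos (d := d) (m := m) (b := b) (M := M) (β := β) (R2 d m b β)
  refine ⟨(|aH| + 2 * M) * (1 + 1 / R2 d m b β) /
      (kappa d m b M β * (phi d m b M β (R2 d m b β) / 2)), by positivity, ?_⟩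
  intro H hH hL haH μ ν hμ hν hμ2 hν2
  have : Nonempty {γ : Measure (EuclideanSpace ℝ (Fin d) × EuclideanSpace ℝ (Fin d)) //
      IsProbabilityMeasure γ ∧ γ.map Prod.fst = μ ∧ γ.map Prod.snd = ν} :=
    ⟨⟨μ.prod ν, inferInstance, by simp, by simp⟩⟩
  rw [← div_le_iff₀' (by positivity)]
  refine le_ciInf fun ⟨γ, hγ, hγμ, hγν⟩ => ?_
  rw [div_le_iff₀' (by positivity)]
  refine abs_integral_sub_le_of_coupling hγμ hγν (hL.integrable hH hM.le hμ2)
    (hL.integrable hH hM.le hν2) (integrable_rho2 ?_ ?_) fun x y => ?_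
  · subst hγμ; exact hμ2.comp_measurable measurable_fst
  · subst hγν; exact hν2.comp_measurable measurable_snd
  · rw [← haH, abs_of_nonneg (norm_nonneg _)]
    exact hL.abs_sub_le_rho2 hd hm hb hM hβ hH x y

end
end
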